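/- Let G be a finite 4-edge-connected undirected graph with destination t ∈ V, and let T_1,T_2,T_3,T_4 be pairwise arc-disjoint arborescences of G rooted at t such that T_1 and T_3 are edge-disjoint and T_2 and T_4 are edge-disjoint. Then the circular-arborescence routing process with cyclic order ⟨T_1,T_2,T_3,T_4⟩ (for every choice of starting arborescence) is 3-resilient against dynamic failures. -/

import Mathlib

namespace FRR

open scoped Classical

variable {V : Type*} [Fintype V] [DecidableEq V]

/-- `G` is `k`-edge-connected: removing any set of at most `k-1` edges keeps it connected. -/
def EdgeConnected (G : SimpleGraph V) (k : ℕ) : Prop :=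
  ∀ F : Set (Sym2 V), F ⊆ G.edgeSet → F.ncard ≤ k - 1 → (G.deleteEdges F).Connected

/-- An arborescence of `G` rooted at `t`, given by a parent map: every node `v ≠ t`
has exactly one outgoing arc `(v, par v)`, and iterating the parent map reaches `t`. -/
structure Arb (G : SimpleGraph V) (t : V) where
  par : V → V
  adj : ∀ v, v ≠ t → G.Adj v (par v)
  reaches : ∀ v, ∃ n : ℕ, par^[n] v = t

/-- The arc `(u, v)` belongs to the arborescence `T`. -/
def Arb.Arc {G : SimpleGraph V} {t : V} (T : Arb G t) (u v : V) : Prop :=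
  u ≠ t ∧ T.par u = v

/-- Two arborescences are arc-disjoint: they share no directed arc. -/
def ArcDisjoint {G : SimpleGraph V} {t : V} (T T' : Arb G t) : Prop :=
  ∀ u v : V, ¬ (T.Arc u v ∧ T'.Arc u v)

/-- Two arborescences are edge-disjoint: no edge of `G` occurs, in either
orientation, in both of them. -/
def EdgeDisjointArb {G : SimpleGraph V} {t : V} (T T' : Arb G t) : Prop :=
  ∀ u v : V, T.Arc u v → ¬ T'.Arc u v ∧ ¬ T'.Arc v u

/-- One step of the circular-arborescence routing process on the cyclic order
`⟨T 0, …, T (m-1)⟩` at time `n`: route canonically along the current arborescence;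
if the outgoing arc is down, switch to the first arborescence after the current one
in the cyclic order whose outgoing arc at the current node is up. -/
noncomputable def circNext {G : SimpleGraph V} {t : V} {m : ℕ}
    (T : Fin m → Arb G t) (σ : ℕ → Set (Sym2 V)) (n : ℕ)
    (v : V) (i : Fin m) : V × Fin m :=
  if v = t then (v, i)
  else if s(v, (T i).par v) ∉ σ n then ((T i).par v, i)
  else if h : ∃ d : ℕ, d < m ∧
      s(v, (T ⟨((i : ℕ) + 1 + d) % m, Nat.mod_lt _ i.pos⟩).par v) ∉ σ n then
    let j : Fin m := ⟨((i : ℕ) + 1 + Nat.find h) % m, Nat.mod_lt _ i.pos⟩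
    ((T j).par v, j)
  else (v, i)

/-- The trajectory of the circular-arborescence routing process started at node `s`
on arborescence `i₀`, under the failure schedule `σ`. -/
noncomputable def circTraj {G : SimpleGraph V} {t : V} {m : ℕ}
    (T : Fin m → Arb G t) (σ : ℕ → Set (Sym2 V)) (s : V) (i₀ : Fin m) :
    ℕ → V × Fin m
  | 0 => (s, i₀)
  | n + 1 => circNext T σ n (circTraj T σ s i₀ n).1 (circTraj T σ s i₀ n).2

/-- The circular-arborescence routing process on `T` is `r`-resilient against dynamic
failures: for every unstable-link set `F` with `|F| ≤ r`, every (dynamic, i.e. arbitrary)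
failure schedule `σ` on `F`, every starting node `s` and starting arborescence `i₀`,
if the trajectory satisfies the non-trap assumption and `s` is connected to `t`
in `G ∖ F`, then the packet reaches `t` after finitely many steps. -/
def CircResilient {G : SimpleGraph V} (t : V) {m : ℕ} (T : Fin m → Arb G t)
    (r : ℕ) : Prop :=
  ∀ F : Set (Sym2 V), F ⊆ G.edgeSet → F.ncard ≤ r →
    ∀ σ : ℕ → Set (Sym2 V), (∀ n, σ n ⊆ F) →
      ∀ (s : V) (i₀ : Fin m),
        (∀ n, (G.deleteEdges F).Reachable (circTraj T σ s i₀ n).1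
            (circTraj T σ s i₀ (n + 1)).1) →
        (G.deleteEdges F).Reachable s t →
        ∃ n, (circTraj T σ s i₀ n).1 = t


def idx (i : Fin 4) (d : ℕ) : Fin 4 := ⟨((i : ℕ) + d) % 4, Nat.mod_lt _ (by norm_num)⟩

lemma idx_zero (i : Fin 4) : idx i 0 = i := by
  apply Fin.ext; have := i.isLt; simp only [idx]; omega

lemma idx_succ (i : Fin 4) (d : ℕ) : idx i (d + 1) = idx i d + 1 := by
  apply Fin.ext; simp only [idx, Fin.val_add]; simp; omega

lemma circNext_eq {G : SimpleGraph V} {t : V} (T : Fin 4 → Arb G t)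
    (σ : ℕ → Set (Sym2 V)) (n : ℕ) (v : V) (hv : v ≠ t) (i : Fin 4) (d : ℕ) (hd : d < 4)
    (hdown : ∀ d' < d, s(v, (T (idx i d')).par v) ∈ σ n)
    (hup : s(v, (T (idx i d)).par v) ∉ σ n) :
    circNext T σ n v i = ((T (idx i d)).par v, idx i d) := by
  unfold circNext
  rw [if_neg hv]
  rcases d with _ | d
  · rw [idx_zero] at hup ⊢
    rw [if_pos hup]
  · have h0 := hdown 0 (by omega)
    rw [idx_zero] at h0
    rw [if_neg (not_not.mpr h0)]
    have key : ∀ d : ℕ, (⟨((i : ℕ) + 1 + d) % 4, Nat.mod_lt _ i.pos⟩ : Fin 4) = idx i (d + 1) := by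
      intro d; apply Fin.ext; simp only [idx]; congr 1; omega
    have h : ∃ d : ℕ, d < 4 ∧
      s(v, (T ⟨((i : ℕ) + 1 + d) % 4, Nat.mod_lt _ i.pos⟩).par v) ∉ σ n :=
      ⟨d, by omega, by rw [key]; exact hup⟩
    rw [dif_pos h]
    have hf : Nat.find h = d := by
      rw [Nat.find_eq_iff]
      refine ⟨⟨by omega, by rw [key]; exact hup⟩, ?_⟩
      intro k hk hk'
      rw [key] at hk'
      exact hk'.2 (hdown (k + 1) (by omega))
    have hf' := key (Nat.find h)
    rw [hf] at hf'
    have hres : ∀ j : Fin 4, j = idx i (d + 1) →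
        ((T j).par v, j) = ((T (idx i (d + 1))).par v, idx i (d + 1)) := by
      rintro j rfl; rfl
    exact hres _ ((key _).trans (by congr 2))

/-- At time `m` the process considers tree `j`. -/
def Att {G : SimpleGraph V} {t : V} (T : Fin 4 → Arb G t)
    (σ : ℕ → Set (Sym2 V)) (s : V) (i₀ : Fin 4) (m : ℕ) (j : Fin 4) : Prop :=
  ∃ d < 4, j = idx (circTraj T σ s i₀ m).2 d ∧
    ∀ d' < d, s((circTraj T σ s i₀ m).1,
      (T (idx (circTraj T σ s i₀ m).2 d')).par (circTraj T σ s i₀ m).1) ∈ σ m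

/-- At time `m` the process hits a failure on tree `j`. -/
def Hit {G : SimpleGraph V} {t : V} (T : Fin 4 → Arb G t)
    (σ : ℕ → Set (Sym2 V)) (s : V) (i₀ : Fin 4) (m : ℕ) (j : Fin 4) : Prop :=
  Att T σ s i₀ m j ∧ s((circTraj T σ s i₀ m).1,
      (T j).par (circTraj T σ s i₀ m).1) ∈ σ m

lemma att_hit {G : SimpleGraph V} {t : V} (T : Fin 4 → Arb G t)
    (σ : ℕ → Set (Sym2 V)) (s : V) (i₀ : Fin 4)
    (hne : ∀ n, (circTraj T σ s i₀ n).1 ≠ t) (j : Fin 4) :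
    ∀ (N m : ℕ), (T j).par^[N] (circTraj T σ s i₀ m).1 = t → Att T σ s i₀ m j →
      ∃ m' k, Hit T σ s i₀ m' j ∧
        (circTraj T σ s i₀ m').1 = (T j).par^[k] (circTraj T σ s i₀ m).1 ∧
        ∀ l ≤ k, (T j).par^[l] (circTraj T σ s i₀ m).1 ≠ t := by
  intro N
  induction N with
  | zero => intro m h; exact absurd h (hne m)
  | succ N ih =>
    intro m hN hA
    by_cases hdown : s((circTraj T σ s i₀ m).1,
      (T j).par (circTraj T σ s i₀ m).1) ∈ σ m
    · exact ⟨m, 0, ⟨hA, hdown⟩, rfl, by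
        intro l hl; obtain rfl : l = 0 := by omega
        exact hne m⟩
    · obtain ⟨d, hd, rfl, hall⟩ := hA
      have hn : circTraj T σ s i₀ (m + 1) = _ :=
        circNext_eq T σ m _ (hne m) (circTraj T σ s i₀ m).2 d hd hall hdown
      set j := idx (circTraj T σ s i₀ m).2 d with hj
      obtain ⟨m', k, hh, hk, hl⟩ := ih (m + 1) (by
        rw [hn]; rw [Function.iterate_succ_apply] at hN; exact hN)
        ⟨0, by norm_num, by rw [idx_zero, hn], by intro d' h; omega⟩
      refine ⟨m', k + 1, hh, ?_, ?_⟩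
      · rw [hk, hn, Function.iterate_succ_apply]
      · intro l hlk
        rcases l with _ | l
        · exact hne m
        · have := hl l (by omega)
          rw [hn] at this
          rw [Function.iterate_succ_apply]; exact this

lemma hit_att {G : SimpleGraph V} {t : V} (T : Fin 4 → Arb G t)
    (hdisj : ∀ i j : Fin 4, i ≠ j → ArcDisjoint (T i) (T j))
    (e : Fin 3 → Sym2 V)
    (σ : ℕ → Set (Sym2 V)) (hσ : ∀ n, σ n ⊆ Set.range e) (s : V) (i₀ : Fin 4)
    (hne : ∀ n, (circTraj T σ s i₀ n).1 ≠ t) (m : ℕ) (j : Fin 4)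
    (h : Hit T σ s i₀ m j) : Att T σ s i₀ m (j + 1) := by
  obtain ⟨⟨d, hd, rfl, hall⟩, hdown⟩ := h
  have hall' : ∀ d' < d + 1, s((circTraj T σ s i₀ m).1,
      (T (idx (circTraj T σ s i₀ m).2 d')).par (circTraj T σ s i₀ m).1) ∈ σ m := by
    intro d' hd'
    rcases Nat.lt_succ_iff_lt_or_eq.mp hd' with h | rfl
    · exact hall _ h
    · exact hdown
  by_cases hd3 : d + 1 < 4
  · exact ⟨d + 1, hd3, (idx_succ _ _).symm, hall'⟩
  · exfalso
    have hd4 : d = 3 := by omega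
    subst hd4
    have : ∀ a : Fin 4, ∃ k, e k = s((circTraj T σ s i₀ m).1,
      (T (idx (circTraj T σ s i₀ m).2 a)).par (circTraj T σ s i₀ m).1) := fun a =>
      hσ m (hall' a a.isLt)
    choose f hf using this
    have hinj : Function.Injective f := by
      intro a b hab
      by_contra hne'
      have h1 := (hf a).symm.trans ((congrArg e hab).trans (hf b))
      rw [Sym2.congr_right] at h1
      refine hdisj (idx (circTraj T σ s i₀ m).2 a) (idx (circTraj T σ s i₀ m).2 b) ?_ _ _
        ⟨⟨hne m, h1⟩, ⟨hne m, rfl⟩⟩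
      intro h
      apply hne'
      have := congrArg Fin.val h
      simp only [idx] at this
      apply Fin.ext; omega
    have := Fintype.card_le_of_injective f hinj
    simp at this

lemma no_cycle {G : SimpleGraph V} {t : V} (T : Arb G t) (w : V)
    (k : ℕ) (hk : T.par^[k + 1] w = w)
    (hn : ∀ l ≤ k, T.par^[l] w ≠ t) : False := by
  obtain ⟨n, hn'⟩ := T.reaches w
  have hp : Function.IsPeriodicPt T.par (k + 1) w := hk
  rw [← hp.iterate_mod_apply] at hn'
  exact hn _ (Nat.lt_succ_iff.mp (Nat.mod_lt _ (Nat.succ_pos k))) hn'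

lemma combi (H : Fin 4 → Fin 3 → Prop)
    (h0 : ∀ i k, H i k → ∃ k', k' ≠ k ∧ H (i + 1) k')
    (hne : ∃ k, H 0 k)
    (h02 : ∀ k, ¬ (H 0 k ∧ H 2 k)) (h13 : ∀ k, ¬ (H 1 k ∧ H 3 k)) : False := by
  have a0 := h0 0
  have a1 := h0 1
  have a2 := h0 2
  have a3 := h0 3
  simp only [Fin.forall_fin_succ, Fin.exists_fin_succ] at *
  simp at *
  grind

/-- Theorem 2: in a 4-edge-connected graph, for four pairwise arc-disjoint
arborescences `T 0, T 1, T 2, T 3` rooted at `t` such that `T 0, T 2` are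
edge-disjoint and `T 1, T 3` are edge-disjoint, the circular-arborescence routing
with cyclic order `⟨T 0, T 1, T 2, T 3⟩` (any starting arborescence) is
3-resilient against dynamic failures. -/
theorem circular_routing_resilient_four_connected
    (G : SimpleGraph V) (t : V) (hconn : EdgeConnected G 4)
    (T : Fin 4 → Arb G t)
    (hdisj : ∀ i j : Fin 4, i ≠ j → ArcDisjoint (T i) (T j))
    (h02 : EdgeDisjointArb (T 0) (T 2))
    (h13 : EdgeDisjointArb (T 1) (T 3)) :
    CircResilient t T 3 := by
  intro F _ hF σ hσ s i₀ _ _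
  by_contra hcon
  push Not at hcon
  have hne := hcon
  obtain ⟨e, he⟩ : ∃ e : Fin 3 → Sym2 V, F ⊆ Set.range e := by
    have hfin : F.Finite := Set.toFinite F
    rcases F.eq_empty_or_nonempty with h | ⟨x, hx⟩
    · exact ⟨fun _ => s(t, t), by simp [h]⟩
    · have : Nonempty F := ⟨⟨x, hx⟩⟩
      have : Fintype F := hfin.fintype
      have hc : Fintype.card F ≤ Fintype.card (Fin 3) := by
        rw [Fintype.card_fin, ← Nat.card_eq_fintype_card, Nat.card_coe_set_eq]; exact hF
      obtain ⟨f⟩ := Function.Embedding.nonempty_of_card_le hc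
      refine ⟨fun k => (Function.invFun f k : F), ?_⟩
      intro y hy
      exact ⟨f ⟨y, hy⟩, by simp [Function.leftInverse_invFun f.injective _]⟩
  have hσ' : ∀ n, σ n ⊆ Set.range e := fun n => (hσ n).trans he
  have hAH : ∀ j m, Att T σ s i₀ m j → ∃ m' k, Hit T σ s i₀ m' j ∧
        (circTraj T σ s i₀ m').1 = (T j).par^[k] (circTraj T σ s i₀ m).1 ∧
        ∀ l ≤ k, (T j).par^[l] (circTraj T σ s i₀ m).1 ≠ t := by
    intro j m h
    obtain ⟨N, hN⟩ := (T j).reaches (circTraj T σ s i₀ m).1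
    exact att_hit T σ s i₀ hne j N m hN h
  have hHA := hit_att T hdisj e σ hσ' s i₀ hne
  let H : Fin 4 → Fin 3 → Prop := fun j k => ∃ m, Hit T σ s i₀ m j ∧
    s((circTraj T σ s i₀ m).1, (T j).par (circTraj T σ s i₀ m).1) = e k
  have hstep : ∀ i k, H i k → ∃ k', k' ≠ k ∧ H (i + 1) k' := by
    rintro i k ⟨m, hh, hek⟩
    obtain ⟨m', l, hh', hl, hlt⟩ := hAH _ _ (hHA m i hh)
    obtain ⟨k', hk'⟩ := hσ' m' hh'.2
    refine ⟨k', ?_, m', hh', hk'.symm⟩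
    rintro rfl
    rw [← hek, Sym2.eq_iff] at hk'
    have hii : i ≠ i + 1 := by clear * -; revert i; decide
    rcases hk' with ⟨h1, h2⟩ | ⟨h1, h2⟩
    · refine hdisj i (i + 1) hii _ _ ⟨⟨hne m, rfl⟩, ⟨hne m, ?_⟩⟩
      rw [h2, h1]
    · refine no_cycle (T (i + 1)) (circTraj T σ s i₀ m).1 l ?_ ?_
      · rw [Function.iterate_succ_apply', ← hl]; exact h1.symm
      · exact hlt
  have hnext : ∀ i, (∃ k, H i k) → ∃ k, H (i + 1) k := fun i ⟨k, h⟩ =>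
    let ⟨k', _, h'⟩ := hstep i k h
    ⟨k', h'⟩
  have hstart : ∃ k, H i₀ k := by
    obtain ⟨m', l, hh', -⟩ := hAH i₀ 0
      ⟨0, by norm_num, by rw [idx_zero]; rfl, by intro d' h; omega⟩
    obtain ⟨k', hk'⟩ := hσ' m' hh'.2
    exact ⟨k', m', hh', hk'.symm⟩
  have h4 : ∀ n : ℕ, ∃ k, H (idx i₀ n) k := by
    intro n
    induction n with
    | zero => rw [idx_zero]; exact hstart
    | succ n ih => rw [idx_succ]; exact hnext _ ih
  have hzero : ∃ k, H 0 k := by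
    have h := h4 (4 - (i₀ : ℕ))
    have : idx i₀ (4 - (i₀ : ℕ)) = 0 := by clear * -; revert i₀; decide
    rwa [this] at h
  have hed : ∀ a b : Fin 4, EdgeDisjointArb (T a) (T b) → ∀ k, ¬ (H a k ∧ H b k) := by
    rintro a b hab k ⟨⟨m, -, h1⟩, ⟨m', -, h2⟩⟩
    have h3 := hab (circTraj T σ s i₀ m).1 _ ⟨hne m, rfl⟩
    rw [← h2, Sym2.eq_iff] at h1
    rcases h1 with ⟨h1, h1'⟩ | ⟨h1, h1'⟩
    · apply h3.1
      rw [h1', h1]; exact ⟨hne m', rfl⟩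
    · apply h3.2
      rw [h1', h1]; exact ⟨hne m', rfl⟩
  exact combi H hstep hzero (hed 0 2 h02) (hed 1 3 h13)

end FRR
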